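/- Let x ∈ U with ω_x = ω_y = 0 and cosθ ≠ 0. Then ad⁴f.g̃1(x) = ad⁴f.g̃2(x) = 0 and [g̃1, ad³f.g̃2](x) = [g̃2, ad³f.g̃1](x) = 0, while [g̃1, ad³f.g̃1](x) = [g̃2, ad³f.g̃2](x) = −a cosψ sinθ e_{v_x} + a sinψ e_{v_y} − a cosψ cosθ e_{v_z}. Consequently, for every covector p = (p_{v_x}, p_{v_y}, p_{v_z}, p_θ, p_ψ, p_φ, p_{ω_x}, p_{ω_y}) ∈ ℝ⁸ with p_θ = p_ψ = p_φ = p_{ω_x} = p_{ω_y} = 0, p_{v_x} = tanθ·p_{v_z} and p_{v_y} = −(tanψ/cosθ)·p_{v_z}, one has ⟨p, [g̃1, ad³f.g̃1](x)⟩ = ⟨p, [g̃2, ad³f.g̃2](x)⟩ = −a p_{v_z}/(cosψ cosθ) and ⟨p, [g̃1, ad³f.g̃2](x)⟩ = ⟨p, [g̃2, ad³f.g̃1](x)⟩ = ⟨p, ad⁴f.g̃1(x)⟩ = ⟨p, ad⁴f.g̃2(x)⟩ = 0. -/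

import Mathlib

open Real

/-- Lie bracket of vector fields on ℝ⁸: [X, Y](x) = DY(x)·X(x) − DX(x)·Y(x). -/
noncomputable def lieBracket (X Y : (Fin 8 → ℝ) → (Fin 8 → ℝ)) :
    (Fin 8 → ℝ) → (Fin 8 → ℝ) :=
  fun x => fderiv ℝ Y x (X x) - fderiv ℝ X x (Y x)

/-- The drift vector field f of (MTCP), in coordinates
x = (v_x, v_y, v_z, θ, ψ, φ, ω_x, ω_y). -/
noncomputable def fMTCP (a gx gy gz : ℝ) : (Fin 8 → ℝ) → (Fin 8 → ℝ) := fun x =>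
  ![a * sin (x 3) * cos (x 4) + gx,
    -a * sin (x 4) + gy,
    a * cos (x 3) * cos (x 4) + gz,
    (x 6 * sin (x 5) + x 7 * cos (x 5)) / cos (x 4),
    x 6 * cos (x 5) - x 7 * sin (x 5),
    tan (x 4) * (x 6 * sin (x 5) + x 7 * cos (x 5)),
    0, 0]

/-- g̃1 = e_{ω_y}. -/
noncomputable def gt1 : (Fin 8 → ℝ) → (Fin 8 → ℝ) := fun _ => Pi.single 7 1

/-- g̃2 = e_{ω_x}. -/
noncomputable def gt2 : (Fin 8 → ℝ) → (Fin 8 → ℝ) := fun _ => Pi.single 6 1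

theorem fderiv_coord (i : Fin 8) (x : Fin 8 → ℝ) :
    fderiv ℝ (fun y : Fin 8 → ℝ => y i) x = ContinuousLinearMap.proj i :=
  (hasFDerivAt_apply i x).fderiv

theorem hasFDerivAt_comp_coord {h : ℝ → ℝ} {h' : ℝ} {i : Fin 8} {x : Fin 8 → ℝ}
    (hh : HasDerivAt h h' (x i)) :
    HasFDerivAt (fun y : Fin 8 → ℝ => h (y i))
      (h' • (ContinuousLinearMap.proj i : (Fin 8 → ℝ) →L[ℝ] ℝ)) x :=
  hh.comp_hasFDerivAt x (hasFDerivAt_apply i x)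

theorem hasFDerivAt_tan_coord {i : Fin 8} {x : Fin 8 → ℝ} (hx : cos (x i) ≠ 0) :
    HasFDerivAt (fun y : Fin 8 → ℝ => tan (y i))
      ((1 / cos (x i) ^ 2) • (ContinuousLinearMap.proj i : (Fin 8 → ℝ) →L[ℝ] ℝ)) x :=
  hasFDerivAt_comp_coord (hasDerivAt_tan hx)

theorem hasFDerivAt_inv_cos_coord {i : Fin 8} {x : Fin 8 → ℝ} (hx : cos (x i) ≠ 0) :
    HasFDerivAt (fun y : Fin 8 → ℝ => (cos (y i))⁻¹)
      ((sin (x i) / cos (x i) ^ 2) • (ContinuousLinearMap.proj i : (Fin 8 → ℝ) →L[ℝ] ℝ)) x := by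
  simpa using hasFDerivAt_comp_coord (h := fun t => (cos t)⁻¹) ((hasDerivAt_cos (x i)).fun_inv hx)

theorem fderiv_eq_fderiv_component {Y : (Fin 8 → ℝ) → (Fin 8 → ℝ)} {x : Fin 8 → ℝ}
    (hY : DifferentiableAt ℝ Y x) (v : Fin 8 → ℝ) (i : Fin 8) :
    fderiv ℝ Y x v i = fderiv ℝ (fun y => Y y i) x v := by
  rw [fderiv_apply hY]
  rfl

theorem lieBracket_congr_right {X Y Z : (Fin 8 → ℝ) → (Fin 8 → ℝ)} {x : Fin 8 → ℝ}
    (hx : cos (x 4) ≠ 0) (h : ∀ y : Fin 8 → ℝ, cos (y 4) ≠ 0 → Y y = Z y) :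
    lieBracket X Y x = lieBracket X Z x := by
  have hc : Continuous fun y : Fin 8 → ℝ => cos (y 4) := by fun_prop
  have he : Y =ᶠ[nhds x] Z := (hc.continuousAt.eventually_ne hx).mono h
  simp only [lieBracket, he.fderiv_eq, he.eq_of_nhds]

/-- The constant vector field `α e_{ω_x} + β e_{ω_y}`. -/
def controlField (α β : ℝ) : (Fin 8 → ℝ) → (Fin 8 → ℝ) := fun _ => ![0, 0, 0, 0, 0, 0, α, β]

theorem gt1_eq_controlField : gt1 = controlField 0 1 := by
  funext x i
  fin_cases i <;> simp [gt1, controlField]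

theorem gt2_eq_controlField : gt2 = controlField 1 0 := by
  funext x i
  fin_cases i <;> simp [gt2, controlField]

/-- Closed form of `ad f.g` for `g = controlField α β`. -/
noncomputable def adControl (α β : ℝ) : (Fin 8 → ℝ) → (Fin 8 → ℝ) := fun x =>
  ![0, 0, 0,
    -(α * sin (x 5) + β * cos (x 5)) / cos (x 4),
    β * sin (x 5) - α * cos (x 5),
    -tan (x 4) * (α * sin (x 5) + β * cos (x 5)),
    0, 0]

/-- Closed form of `ad² f.g` for `g = controlField α β`. -/
noncomputable def adSqControl (a α β : ℝ) : (Fin 8 → ℝ) → (Fin 8 → ℝ) := fun x =>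
  ![a * (cos (x 3) * (α * sin (x 5) + β * cos (x 5))
      + sin (x 3) * sin (x 4) * (β * sin (x 5) - α * cos (x 5))),
    a * cos (x 4) * (β * sin (x 5) - α * cos (x 5)),
    a * (cos (x 3) * sin (x 4) * (β * sin (x 5) - α * cos (x 5))
      - sin (x 3) * (α * sin (x 5) + β * cos (x 5))),
    0, 0, α * x 7 - β * x 6, 0, 0]

/-- Closed form of `ad³ f.g` for `g = controlField α β`. -/
noncomputable def adCubeControl (a α β : ℝ) : (Fin 8 → ℝ) → (Fin 8 → ℝ) := fun x =>
  ![-(α * x 6 + β * x 7) * (a * sin (x 3) * cos (x 4)),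
    (α * x 6 + β * x 7) * (a * sin (x 4)),
    -(α * x 6 + β * x 7) * (a * cos (x 3) * cos (x 4)),
    (β * x 6 - α * x 7) * (x 6 * cos (x 5) - x 7 * sin (x 5)) / cos (x 4),
    -(β * x 6 - α * x 7) * (x 6 * sin (x 5) + x 7 * cos (x 5)),
    (β * x 6 - α * x 7) * (tan (x 4) * (x 6 * cos (x 5) - x 7 * sin (x 5))),
    0, 0]

theorem differentiableAt_fMTCP (a gx gy gz : ℝ) {x : Fin 8 → ℝ}
    (hx : cos (x 4) ≠ 0) : DifferentiableAt ℝ (fMTCP a gx gy gz) x := by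
  have ht := (hasFDerivAt_tan_coord hx).differentiableAt
  rw [differentiableAt_pi]
  intro i
  fin_cases i <;> simp [fMTCP] <;> fun_prop (disch := assumption)

theorem fderiv_fMTCP (a gx gy gz : ℝ) {x : Fin 8 → ℝ} (hx : cos (x 4) ≠ 0)
    (v : Fin 8 → ℝ) :
    fderiv ℝ (fMTCP a gx gy gz) x v =
      ![a * (cos (x 3) * cos (x 4) * v 3 - sin (x 3) * sin (x 4) * v 4),
        -a * cos (x 4) * v 4,
        -a * (sin (x 3) * cos (x 4) * v 3 + cos (x 3) * sin (x 4) * v 4),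
        (x 6 * sin (x 5) + x 7 * cos (x 5)) * (sin (x 4) / cos (x 4) ^ 2 * v 4)
          + ((x 6 * cos (x 5) - x 7 * sin (x 5)) * v 5 + sin (x 5) * v 6 + cos (x 5) * v 7)
            / cos (x 4),
        -(x 6 * sin (x 5) + x 7 * cos (x 5)) * v 5 + cos (x 5) * v 6 - sin (x 5) * v 7,
        (x 6 * sin (x 5) + x 7 * cos (x 5)) * (v 4 / cos (x 4) ^ 2)
          + tan (x 4)
            * ((x 6 * cos (x 5) - x 7 * sin (x 5)) * v 5 + sin (x 5) * v 6 + cos (x 5) * v 7),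
        0, 0] := by
  have ht := (hasFDerivAt_tan_coord hx).differentiableAt
  ext i
  rw [fderiv_eq_fderiv_component (differentiableAt_fMTCP a gx gy gz hx)]
  fin_cases i <;>
    simp (disch := first | assumption | fun_prop (disch := assumption))
      [fMTCP, div_eq_mul_inv, fderiv_fun_add, fderiv_fun_sub, fderiv_fun_mul, fderiv_sin,
        fderiv_cos, (hasFDerivAt_tan_coord hx).fderiv, (hasFDerivAt_inv_cos_coord hx).fderiv,
        fderiv_coord] <;>
    ring

theorem differentiableAt_adControl (α β : ℝ) {x : Fin 8 → ℝ}
    (hx : cos (x 4) ≠ 0) : DifferentiableAt ℝ (adControl α β) x := by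
  have ht := (hasFDerivAt_tan_coord hx).differentiableAt
  rw [differentiableAt_pi]
  intro i
  fin_cases i <;> simp [adControl] <;> fun_prop (disch := assumption)

theorem fderiv_adControl (α β : ℝ) {x : Fin 8 → ℝ} (hx : cos (x 4) ≠ 0)
    (v : Fin 8 → ℝ) :
    fderiv ℝ (adControl α β) x v =
      ![0, 0, 0,
        -(α * sin (x 5) + β * cos (x 5)) * (sin (x 4) / cos (x 4) ^ 2 * v 4)
          + (β * sin (x 5) - α * cos (x 5)) * v 5 / cos (x 4),
        (α * sin (x 5) + β * cos (x 5)) * v 5,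
        -(α * sin (x 5) + β * cos (x 5)) * (v 4 / cos (x 4) ^ 2)
          + tan (x 4) * ((β * sin (x 5) - α * cos (x 5)) * v 5),
        0, 0] := by
  have ht := (hasFDerivAt_tan_coord hx).differentiableAt
  ext i
  rw [fderiv_eq_fderiv_component (differentiableAt_adControl α β hx)]
  fin_cases i <;>
    simp (disch := first | assumption | fun_prop (disch := assumption))
      [adControl, div_eq_mul_inv, fderiv_fun_add, fderiv_fun_sub, fderiv_fun_mul, fderiv_sin,
        fderiv_cos, (hasFDerivAt_tan_coord hx).fderiv, (hasFDerivAt_inv_cos_coord hx).fderiv,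
        fderiv_coord] <;>
    ring

theorem differentiableAt_adSqControl (a α β : ℝ) {x : Fin 8 → ℝ} :
    DifferentiableAt ℝ (adSqControl a α β) x := by
  rw [differentiableAt_pi]
  intro i
  fin_cases i <;> simp [adSqControl] <;> fun_prop

theorem fderiv_adSqControl (a α β : ℝ) {x : Fin 8 → ℝ}
    (v : Fin 8 → ℝ) :
    fderiv ℝ (adSqControl a α β) x v =
      ![a * (-sin (x 3) * (α * sin (x 5) + β * cos (x 5))
            + cos (x 3) * sin (x 4) * (β * sin (x 5) - α * cos (x 5))) * v 3
          + a * sin (x 3) * cos (x 4) * (β * sin (x 5) - α * cos (x 5)) * v 4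
          + a * (cos (x 3) * (α * cos (x 5) - β * sin (x 5))
            + sin (x 3) * sin (x 4) * (α * sin (x 5) + β * cos (x 5))) * v 5,
        -a * sin (x 4) * (β * sin (x 5) - α * cos (x 5)) * v 4
          + a * cos (x 4) * (α * sin (x 5) + β * cos (x 5)) * v 5,
        -a * (sin (x 3) * sin (x 4) * (β * sin (x 5) - α * cos (x 5))
            + cos (x 3) * (α * sin (x 5) + β * cos (x 5))) * v 3
          + a * cos (x 3) * cos (x 4) * (β * sin (x 5) - α * cos (x 5)) * v 4
          + a * (cos (x 3) * sin (x 4) * (α * sin (x 5) + β * cos (x 5))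
            + sin (x 3) * (β * sin (x 5) - α * cos (x 5))) * v 5,
        0, 0, α * v 7 - β * v 6, 0, 0] := by
  ext i
  rw [fderiv_eq_fderiv_component (differentiableAt_adSqControl a α β)]
  fin_cases i <;>
    simp (disch := fun_prop)
      [adSqControl, fderiv_fun_add, fderiv_fun_sub, fderiv_fun_mul, fderiv_sin,
        fderiv_cos, fderiv_coord] <;>
    ring

theorem differentiableAt_adCubeControl (a α β : ℝ) {x : Fin 8 → ℝ}
    (hx : cos (x 4) ≠ 0) : DifferentiableAt ℝ (adCubeControl a α β) x := by
  have ht := (hasFDerivAt_tan_coord hx).differentiableAt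
  rw [differentiableAt_pi]
  intro i
  fin_cases i <;> simp [adCubeControl] <;> fun_prop (disch := assumption)

theorem fderiv_adCubeControl (a α β : ℝ) {x : Fin 8 → ℝ} (hx : cos (x 4) ≠ 0)
    (hωx : x 6 = 0) (hωy : x 7 = 0)
    (v : Fin 8 → ℝ) :
    fderiv ℝ (adCubeControl a α β) x v =
      ![-(α * v 6 + β * v 7) * (a * sin (x 3) * cos (x 4)),
        (α * v 6 + β * v 7) * (a * sin (x 4)),
        -(α * v 6 + β * v 7) * (a * cos (x 3) * cos (x 4)),
        0, 0, 0, 0, 0] := by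
  have ht := (hasFDerivAt_tan_coord hx).differentiableAt
  ext i
  rw [fderiv_eq_fderiv_component (differentiableAt_adCubeControl a α β hx)]
  fin_cases i <;>
    simp (disch := first | assumption | fun_prop (disch := assumption))
      [adCubeControl, hωx, hωy, div_eq_mul_inv, fderiv_fun_add, fderiv_fun_sub, fderiv_fun_mul, fderiv_sin,
        fderiv_cos, (hasFDerivAt_tan_coord hx).fderiv, (hasFDerivAt_inv_cos_coord hx).fderiv,
        fderiv_coord] <;>
    ring

theorem lieBracket_fMTCP_controlField (a gx gy gz α β : ℝ) {x : Fin 8 → ℝ}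
    (hx : cos (x 4) ≠ 0) :
    lieBracket (fMTCP a gx gy gz) (controlField α β) x = adControl α β x := by
  have hc : fderiv ℝ (controlField α β) x = 0 := (hasFDerivAt_const _ x).fderiv
  rw [lieBracket, fderiv_fMTCP a gx gy gz hx, hc]
  ext i
  fin_cases i <;> simp [controlField, adControl, -mul_eq_mul_left_iff] <;> ring

theorem lieBracket_fMTCP_adControl (a gx gy gz α β : ℝ) {x : Fin 8 → ℝ}
    (hx : cos (x 4) ≠ 0) :
    lieBracket (fMTCP a gx gy gz) (adControl α β) x = adSqControl a α β x := by
  rw [lieBracket, fderiv_fMTCP a gx gy gz hx, fderiv_adControl α β hx]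
  have h5 := sin_sq_add_cos_sq (x 5)
  have h4 := sin_sq (x 4)
  ext i
  fin_cases i <;> simp [fMTCP, adControl, adSqControl, tan_eq_sin_div_cos, -mul_eq_mul_left_iff] <;> field_simp
  all_goals grind

theorem lieBracket_fMTCP_adSqControl (a gx gy gz α β : ℝ) {x : Fin 8 → ℝ}
    (hx : cos (x 4) ≠ 0) :
    lieBracket (fMTCP a gx gy gz) (adSqControl a α β) x = adCubeControl a α β x := by
  rw [lieBracket, fderiv_fMTCP a gx gy gz hx, fderiv_adSqControl a α β]
  have h5 := sin_sq_add_cos_sq (x 5)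
  have h4 := sin_sq (x 4)
  ext i
  fin_cases i <;> simp [fMTCP, adSqControl, adCubeControl, tan_eq_sin_div_cos, -mul_eq_mul_left_iff] <;> field_simp
  all_goals grind

theorem ad_cube_fMTCP_controlField (a gx gy gz α β : ℝ) {x : Fin 8 → ℝ}
    (hx : cos (x 4) ≠ 0) :
    lieBracket (fMTCP a gx gy gz) (lieBracket (fMTCP a gx gy gz)
      (lieBracket (fMTCP a gx gy gz) (controlField α β))) x = adCubeControl a α β x := by
  rw [← lieBracket_fMTCP_adSqControl a gx gy gz α β hx]
  refine lieBracket_congr_right hx fun y hy => ?_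
  rw [← lieBracket_fMTCP_adControl a gx gy gz α β hy]
  exact lieBracket_congr_right hy fun z hz => lieBracket_fMTCP_controlField a gx gy gz α β hz

theorem ad_four_fMTCP_controlField (a gx gy gz α β : ℝ) {x : Fin 8 → ℝ}
    (hx : cos (x 4) ≠ 0) (hωx : x 6 = 0) (hωy : x 7 = 0) :
    lieBracket (fMTCP a gx gy gz) (lieBracket (fMTCP a gx gy gz) (lieBracket (fMTCP a gx gy gz)
      (lieBracket (fMTCP a gx gy gz) (controlField α β)))) x = 0 := by
  rw [lieBracket_congr_right hx fun y hy => ad_cube_fMTCP_controlField a gx gy gz α β hy,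
    lieBracket, fderiv_fMTCP a gx gy gz hx, fderiv_adCubeControl a α β hx hωx hωy]
  ext i
  fin_cases i <;> simp [fMTCP, adCubeControl, hωx, hωy]

theorem lieBracket_controlField_ad_cube (a gx gy gz α β γ δ : ℝ) {x : Fin 8 → ℝ}
    (hx : cos (x 4) ≠ 0) (hωx : x 6 = 0) (hωy : x 7 = 0) :
    lieBracket (controlField γ δ) (lieBracket (fMTCP a gx gy gz) (lieBracket (fMTCP a gx gy gz)
      (lieBracket (fMTCP a gx gy gz) (controlField α β)))) x =
      (α * γ + β * δ) • ![-(a * cos (x 4) * sin (x 3)), a * sin (x 4),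
        -(a * cos (x 4) * cos (x 3)), 0, 0, 0, 0, 0] := by
  have hc : fderiv ℝ (controlField γ δ) x = 0 := (hasFDerivAt_const _ x).fderiv
  rw [lieBracket_congr_right hx fun y hy => ad_cube_fMTCP_controlField a gx gy gz α β hy,
    lieBracket, hc, fderiv_adCubeControl a α β hx hωx hωy]
  ext i
  fin_cases i <;> simp [controlField] <;> ring

/- STATEMENT 7: brackets of order 3 and 4 on the singular locus ω_x = ω_y = 0,
and the induced pairings with covectors on the singular surface. -/
theorem singular_surface_brackets (a gx gy gz : ℝ) (x : Fin 8 → ℝ)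
    (hx : cos (x 4) ≠ 0) (hθ : cos (x 3) ≠ 0) (hωx : x 6 = 0) (hωy : x 7 = 0) :
    lieBracket (fMTCP a gx gy gz)
      (lieBracket (fMTCP a gx gy gz)
        (lieBracket (fMTCP a gx gy gz) (lieBracket (fMTCP a gx gy gz) gt1))) x = 0 ∧
    lieBracket (fMTCP a gx gy gz)
      (lieBracket (fMTCP a gx gy gz)
        (lieBracket (fMTCP a gx gy gz) (lieBracket (fMTCP a gx gy gz) gt2))) x = 0 ∧
    lieBracket gt1
      (lieBracket (fMTCP a gx gy gz)
        (lieBracket (fMTCP a gx gy gz) (lieBracket (fMTCP a gx gy gz) gt2))) x = 0 ∧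
    lieBracket gt2
      (lieBracket (fMTCP a gx gy gz)
        (lieBracket (fMTCP a gx gy gz) (lieBracket (fMTCP a gx gy gz) gt1))) x = 0 ∧
    lieBracket gt1
      (lieBracket (fMTCP a gx gy gz)
        (lieBracket (fMTCP a gx gy gz) (lieBracket (fMTCP a gx gy gz) gt1))) x =
      ![-(a * cos (x 4) * sin (x 3)), a * sin (x 4), -(a * cos (x 4) * cos (x 3)),
        0, 0, 0, 0, 0] ∧
    lieBracket gt2
      (lieBracket (fMTCP a gx gy gz)
        (lieBracket (fMTCP a gx gy gz) (lieBracket (fMTCP a gx gy gz) gt2))) x =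
      ![-(a * cos (x 4) * sin (x 3)), a * sin (x 4), -(a * cos (x 4) * cos (x 3)),
        0, 0, 0, 0, 0] ∧
    (∀ p : Fin 8 → ℝ,
      p 3 = 0 → p 4 = 0 → p 5 = 0 → p 6 = 0 → p 7 = 0 →
      p 0 = tan (x 3) * p 2 → p 1 = -(tan (x 4) / cos (x 3)) * p 2 →
      (∑ i, p i * lieBracket gt1
        (lieBracket (fMTCP a gx gy gz)
          (lieBracket (fMTCP a gx gy gz) (lieBracket (fMTCP a gx gy gz) gt1))) x i)
        = -(a * p 2) / (cos (x 4) * cos (x 3)) ∧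
      (∑ i, p i * lieBracket gt2
        (lieBracket (fMTCP a gx gy gz)
          (lieBracket (fMTCP a gx gy gz) (lieBracket (fMTCP a gx gy gz) gt2))) x i)
        = -(a * p 2) / (cos (x 4) * cos (x 3)) ∧
      (∑ i, p i * lieBracket gt1
        (lieBracket (fMTCP a gx gy gz)
          (lieBracket (fMTCP a gx gy gz) (lieBracket (fMTCP a gx gy gz) gt2))) x i) = 0 ∧
      (∑ i, p i * lieBracket gt2
        (lieBracket (fMTCP a gx gy gz)
          (lieBracket (fMTCP a gx gy gz) (lieBracket (fMTCP a gx gy gz) gt1))) x i) = 0 ∧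
      (∑ i, p i * lieBracket (fMTCP a gx gy gz)
        (lieBracket (fMTCP a gx gy gz)
          (lieBracket (fMTCP a gx gy gz) (lieBracket (fMTCP a gx gy gz) gt1))) x i) = 0 ∧
      (∑ i, p i * lieBracket (fMTCP a gx gy gz)
        (lieBracket (fMTCP a gx gy gz)
          (lieBracket (fMTCP a gx gy gz) (lieBracket (fMTCP a gx gy gz) gt2))) x i) = 0) := by
  have h4 := ad_four_fMTCP_controlField a gx gy gz (x := x)
  have h3 := lieBracket_controlField_ad_cube a gx gy gz (x := x)
  have hpair : ∀ p : Fin 8 → ℝ, p 0 = tan (x 3) * p 2 →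
      p 1 = -(tan (x 4) / cos (x 3)) * p 2 →
      ∑ i, p i * (![-(a * cos (x 4) * sin (x 3)), a * sin (x 4), -(a * cos (x 4) * cos (x 3)),
        0, 0, 0, 0, 0] : Fin 8 → ℝ) i = -(a * p 2) / (cos (x 4) * cos (x 3)) := by
    intro p h0 h1
    have hs3 := sin_sq_add_cos_sq (x 3)
    have hs4 := sin_sq_add_cos_sq (x 4)
    simp [Fin.sum_univ_eight, h0, h1, tan_eq_sin_div_cos]
    field_simp
    grind
  simp only [gt1_eq_controlField, gt2_eq_controlField, h4 _ _ hx hωx hωy,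
    h3 _ _ _ _ hx hωx hωy]
  simp only [mul_zero, mul_one, add_zero, zero_add, zero_smul, one_smul, Pi.zero_apply,
    Finset.sum_const_zero, true_and, and_true]
  exact fun p _ _ _ _ _ h0 h1 => ⟨hpair p h0 h1, hpair p h0 h1⟩
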